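/- For every real λ > 0, every real ν ≥ 0, and every φ ∈ (0,π), one has (sin φ)^{2λ−1} · ʳG_ν^{(λ)}(cos φ) = (2^λ Γ(λ+1/2))/(√π Γ(λ)) · ∫_0^φ cos((ν+λ)ϑ) · (cos ϑ − cos φ)^{λ−1} dϑ. -/

import Mathlib

open Real

/-- Pochhammer symbol `(a)_n = a (a+1) ⋯ (a+n-1)` for a real base. -/
noncomputable def poch (a : ℝ) (n : ℕ) : ℝ := ∏ i ∈ Finset.range n, (a + (i : ℝ))

/-- The right generalized Gegenbauer function of fractional degree `ν` and parameter `λ`: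
`ʳG_ν^{(λ)}(x) = Σ_{j=0}^∞ ((−ν)_j (ν+2λ)_j)/(j! (λ+1/2)_j) ((1−x)/2)^j`
(the `j = 0` term equals `1`). -/
noncomputable def rG (lam nu x : ℝ) : ℝ :=
  ∑' j : ℕ, (poch (-nu) j * poch (nu + 2 * lam) j /
    ((j.factorial : ℝ) * poch (lam + 1 / 2) j)) * ((1 - x) / 2) ^ j

noncomputable def hyp (A B C : ℝ) : PowerSeries ℝ :=
  PowerSeries.mk fun n => poch A n * poch B n / ((n.factorial : ℝ) * poch C n)

noncomputable def binS (s : ℝ) : PowerSeries ℝ :=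
  PowerSeries.mk fun n => poch s n / (n.factorial : ℝ)

lemma poch_succ (a : ℝ) (n : ℕ) : poch a (n+1) = poch a n * (a + n) := by
  simp [poch, Finset.prod_range_succ]
lemma poch_zero (a : ℝ) : poch a 0 = 1 := by simp [poch]
lemma poch_pos {a : ℝ} (ha : 0 < a) (n : ℕ) : 0 < poch a n :=
  Finset.prod_pos fun i _ => by positivity

lemma Gamma_poch {a : ℝ} (ha : 0 < a) (n : ℕ) : Real.Gamma (a + n) = poch a n * Real.Gamma a := by
  induction n with
  | zero => simp [poch_zero]
  | succ n ih =>
    have : a + ((n+1 : ℕ):ℝ) = (a + n) + 1 := by push_cast; ring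
    rw [this, Real.Gamma_add_one (by positivity), ih, poch_succ]; ring

lemma hyp_rec (A B C : ℝ) (hC : 0 < C) (n : ℕ) :
    ((n:ℝ)+1) * (C + n) * PowerSeries.coeff (n+1) (hyp A B C) =
      (A + n) * (B + n) * PowerSeries.coeff n (hyp A B C) := by
  have := (poch_pos hC n).ne'
  have h2 : (n.factorial : ℝ) ≠ 0 := by positivity
  have h3 : C + n ≠ 0 := by positivity
  simp only [hyp, PowerSeries.coeff_mk, poch_succ, Nat.factorial_succ]
  push_cast
  field_simp

noncomputable def hypL (A B C : ℝ) (f : PowerSeries ℝ) : PowerSeries ℝ :=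
  PowerSeries.X * (1 - PowerSeries.X) * PowerSeries.derivative ℝ (PowerSeries.derivative ℝ f)
    + (PowerSeries.C C - PowerSeries.C (A + B + 1) * PowerSeries.X) * PowerSeries.derivative ℝ f
    - PowerSeries.C (A * B) * f

lemma hypL_coeff (A B C : ℝ) (f : PowerSeries ℝ) (n : ℕ) :
    PowerSeries.coeff n (hypL A B C f) =
      ((n:ℝ)+1) * (C + n) * PowerSeries.coeff (n+1) f -
      (A + n) * (B + n) * PowerSeries.coeff n f := by
  have : hypL A B C f = PowerSeries.X * (PowerSeries.derivative ℝ (PowerSeries.derivative ℝ f)) - PowerSeries.X * (PowerSeries.X * PowerSeries.derivative ℝ (PowerSeries.derivative ℝ f))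
    + PowerSeries.C C * PowerSeries.derivative ℝ f - PowerSeries.C (A + B + 1) * (PowerSeries.X * PowerSeries.derivative ℝ f)
    - PowerSeries.C (A * B) * f := by unfold hypL; ring
  rw [this]
  rcases n with _ | _ | n
  · simp only [map_sub, map_add (PowerSeries.coeff _), PowerSeries.coeff_C_mul, PowerSeries.coeff_zero_X_mul,
      PowerSeries.coeff_derivative]
    push_cast; ring
  · simp only [map_sub, map_add (PowerSeries.coeff _), PowerSeries.coeff_C_mul, PowerSeries.coeff_zero_X_mul,
      PowerSeries.coeff_succ_X_mul, PowerSeries.coeff_derivative]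
    push_cast; ring
  · simp only [map_sub, map_add (PowerSeries.coeff _), PowerSeries.coeff_C_mul,
      PowerSeries.coeff_succ_X_mul, PowerSeries.coeff_derivative]
    push_cast; ring

lemma hypL_hyp (A B C : ℝ) (hC : 0 < C) : hypL A B C (hyp A B C) = 0 := by
  ext n
  rw [hypL_coeff, hyp_rec _ _ _ hC]; simp

lemma hypL_unique (A B C : ℝ) (hC : 0 < C) (f g : PowerSeries ℝ) (hf : hypL A B C f = 0)
    (hg : hypL A B C g = 0) (h0 : PowerSeries.coeff 0 f = PowerSeries.coeff 0 g) : f = g := by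
  ext n
  induction n with
  | zero => exact h0
  | succ n ih =>
    have h1 := hypL_coeff A B C f n
    have h2 := hypL_coeff A B C g n
    rw [hf] at h1
    rw [hg, ← ih] at h2
    have h3 : ((n:ℝ)+1) * (C + n) ≠ 0 := by positivity
    apply mul_left_cancel₀ h3
    simp at h1 h2
    linarith

lemma binS_ode (s : ℝ) : (1 - PowerSeries.X) * PowerSeries.derivative ℝ (binS s) = PowerSeries.C s * binS s := by
  ext n
  have h2 : (n.factorial : ℝ) ≠ 0 := by positivity
  rw [sub_mul, one_mul]
  rcases n with _ | n
  · simp [PowerSeries.coeff_derivative, binS, poch_succ, poch_zero, -PowerSeries.coeff_zero_eq_constantCoeff, PowerSeries.coeff_zero_X_mul]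
  · simp [PowerSeries.coeff_derivative, binS, PowerSeries.coeff_succ_X_mul, poch_succ, Nat.factorial_succ] 
    field_simp
    ring

lemma euler_formal (A B C : ℝ) (hC : 0 < C) :
    hyp A B C = binS (A + B - C) * hyp (C - A) (C - B) C := by
  apply hypL_unique A B C hC _ _ (hypL_hyp A B C hC)
  · have hP := binS_ode (A + B - C)
    have hP2 := congrArg (PowerSeries.derivative ℝ) hP
    have hF := hypL_hyp (C - A) (C - B) C hC
    set P := binS (A + B - C)
    set F := hyp (C - A) (C - B) C
    unfold hypL at hF ⊢
    simp only [Derivation.leibniz, map_sub, map_add, map_mul, smul_eq_mul, map_one, PowerSeries.derivative_C, PowerSeries.derivative_X, Derivation.map_one_eq_zero] at hP hP2 hF ⊢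
    have hne : (1 - PowerSeries.X : PowerSeries ℝ) ≠ 0 := by
      intro h
      have := congrArg (PowerSeries.coeff 0) h
      simp at this
    apply mul_left_cancel₀ hne
    rw [mul_zero]
    generalize PowerSeries.C A = a at *
    generalize PowerSeries.C B = b at *
    generalize PowerSeries.C C = c at *
    generalize (PowerSeries.X : PowerSeries ℝ) = x at *
    generalize PowerSeries.derivative ℝ (PowerSeries.derivative ℝ P) = P2 at *
    generalize PowerSeries.derivative ℝ (PowerSeries.derivative ℝ F) = F2 at *
    generalize PowerSeries.derivative ℝ P = P1 at *
    generalize PowerSeries.derivative ℝ F = F1 at *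
    linear_combination (1-x)*P*hF + (x*(1-x)*F)*hP2 + (2*x*(1-x)*F1 + x*F*(a+b-c+1) + (c-(a+b+1)*x)*F )*hP
  · simp [hyp, binS, poch_zero]

/-- Power series convergent on `(-1,1)`. -/
def good (p : PowerSeries ℝ) : Prop :=
  ∀ y : ℝ, |y| < 1 → Summable fun n => PowerSeries.coeff n p * y ^ n

noncomputable def ev (p : PowerSeries ℝ) (y : ℝ) : ℝ := ∑' n, PowerSeries.coeff n p * y ^ n

lemma good_add {p q : PowerSeries ℝ} (hp : good p) (hq : good q) : good (p + q) := by
  intro y hy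
  simpa [add_mul] using (hp y hy).add (hq y hy)

lemma ev_add {p q : PowerSeries ℝ} (hp : good p) (hq : good q) {y : ℝ} (hy : |y| < 1) :
    ev (p + q) y = ev p y + ev q y := by
  unfold ev
  rw [← (hp y hy).tsum_add (hq y hy)]
  simp [add_mul]

lemma good_sub {p q : PowerSeries ℝ} (hp : good p) (hq : good q) : good (p - q) := by
  intro y hy
  simpa [sub_mul] using (hp y hy).sub (hq y hy)

lemma ev_sub {p q : PowerSeries ℝ} (hp : good p) (hq : good q) {y : ℝ} (hy : |y| < 1) :
    ev (p - q) y = ev p y - ev q y := by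
  unfold ev
  rw [← (hp y hy).tsum_sub (hq y hy)]
  simp [sub_mul]

lemma coeff_mul_aux (p q : PowerSeries ℝ) (y : ℝ) (n : ℕ) :
    PowerSeries.coeff n (p * q) * y ^ n = ∑ kl ∈ Finset.HasAntidiagonal.antidiagonal n,
      (PowerSeries.coeff kl.1 p * y ^ kl.1) * (PowerSeries.coeff kl.2 q * y ^ kl.2) := by
  rw [PowerSeries.coeff_mul, Finset.sum_mul]
  refine Finset.sum_congr rfl fun kl hkl => ?_
  rw [← Finset.HasAntidiagonal.mem_antidiagonal.1 hkl, pow_add]; ring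

lemma good_mul {p q : PowerSeries ℝ} (hp : good p) (hq : good q) : good (p * q) := by
  intro y hy
  simp_rw [coeff_mul_aux]
  exact (summable_norm_sum_mul_antidiagonal_of_summable_norm (hp y hy).norm (hq y hy).norm).of_norm

lemma ev_mul {p q : PowerSeries ℝ} (hp : good p) (hq : good q) {y : ℝ} (hy : |y| < 1) :
    ev (p * q) y = ev p y * ev q y := by
  unfold ev
  rw [tsum_mul_tsum_eq_tsum_sum_antidiagonal_of_summable_norm (hp y hy).norm (hq y hy).norm]
  simp_rw [coeff_mul_aux]

lemma hasSum_C (c y : ℝ) :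
    HasSum (fun n => PowerSeries.coeff n (PowerSeries.C c : PowerSeries ℝ) * y ^ n) c := by
  have := hasSum_single (f := fun n => PowerSeries.coeff n (PowerSeries.C c : PowerSeries ℝ) * y ^ n) 0
    (fun n hn => by simp [PowerSeries.coeff_C, hn])
  simpa using this

lemma good_C (c : ℝ) : good (PowerSeries.C c) := fun y _ => (hasSum_C c y).summable
lemma ev_C (c y : ℝ) : ev (PowerSeries.C c) y = c := (hasSum_C c y).tsum_eq
lemma good_one : good 1 := by simpa using good_C 1
lemma ev_one (y : ℝ) : ev 1 y = 1 := by simpa using ev_C 1 y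

lemma hasSum_X (y : ℝ) :
    HasSum (fun n => PowerSeries.coeff n (PowerSeries.X : PowerSeries ℝ) * y ^ n) y := by
  have := hasSum_single (f := fun n => PowerSeries.coeff n (PowerSeries.X : PowerSeries ℝ) * y ^ n) 1
    (fun n hn => by simp [PowerSeries.coeff_X, hn])
  simpa using this

lemma good_X : good PowerSeries.X := fun y _ => (hasSum_X y).summable
lemma ev_X (y : ℝ) : ev PowerSeries.X y = y := (hasSum_X y).tsum_eq

/-- derivative bound summability -/
lemma good_bound {p : PowerSeries ℝ} (hp : good p) {r : ℝ} (hr0 : 0 ≤ r) (hr : r < 1) :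
    Summable fun n : ℕ => |PowerSeries.coeff n p| * (n * r ^ (n - 1)) := by
  obtain ⟨R, hR1, hR2⟩ := exists_between hr
  have hR : 0 < R := hr0.trans_lt hR1
  have h1 := (hp R (by rw [abs_of_pos hR]; exact hR2)).tendsto_atTop_zero
  obtain ⟨M, hM⟩ := h1.norm.bddAbove_range
  have hq : ‖r / R‖ < 1 := by
    rw [Real.norm_eq_abs, abs_of_nonneg (by positivity), div_lt_one hR]; exact hR1
  rw [← summable_nat_add_iff 1]
  have h2 : Summable fun n : ℕ => M / R * (((n:ℝ) + 1) * (r / R) ^ n) := by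
    apply Summable.mul_left
    have a := summable_pow_mul_geometric_of_norm_lt_one 1 hq
    have b := summable_pow_mul_geometric_of_norm_lt_one 0 hq
    simpa [add_mul] using a.add b
  refine Summable.of_nonneg_of_le (fun n => by positivity) (fun n => ?_) h2
  have h3 : ‖PowerSeries.coeff (n+1) p * R ^ (n+1)‖ ≤ M := hM ⟨n+1, rfl⟩
  rw [norm_mul, Real.norm_eq_abs, Real.norm_eq_abs, abs_of_pos (pow_pos hR _)] at h3
  have h4 : |PowerSeries.coeff (n+1) p| ≤ M / R ^ (n+1) := by
    rw [le_div_iff₀ (by positivity)]; exact h3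
  calc _ ≤ M / R ^ (n+1) * (((n+1 : ℕ):ℝ) * r ^ (n+1-1)) := by gcongr
    _ = _ := by
      simp only [Nat.add_sub_cancel, div_pow]; push_cast; field_simp; ring

lemma good_D {p : PowerSeries ℝ} (hp : good p) : good (PowerSeries.derivative ℝ p) := by
  intro y hy
  have h := good_bound hp (abs_nonneg y) hy
  rw [← summable_nat_add_iff 1] at h
  refine Summable.of_norm (h.congr fun n => ?_)
  rw [PowerSeries.coeff_derivative]
  simp only [Nat.add_sub_cancel, norm_mul, Real.norm_eq_abs, abs_pow]
  rw [abs_of_nonneg (by positivity : (0:ℝ) ≤ n + 1)]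
  push_cast; ring

lemma hasDerivAt_ev {p : PowerSeries ℝ} (hp : good p) {y : ℝ} (hy : |y| < 1) :
    HasDerivAt (ev p) (ev (PowerSeries.derivative ℝ p) y) y := by
  obtain ⟨r, hr1, hr2⟩ := exists_between hy
  have hr : 0 < r := (abs_nonneg y).trans_lt hr1
  have h := good_bound hp hr.le hr2
  have key := hasDerivAt_tsum_of_isPreconnected (t := Set.Ioo (-r) r)
    (g := fun n z => PowerSeries.coeff n p * z ^ n)
    (g' := fun n z => PowerSeries.coeff n p * (n * z ^ (n-1))) h isOpen_Ioo isPreconnected_Ioo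
    (fun n z _ => (hasDerivAt_pow n z).const_mul _)
    (fun n z hz => by
      rw [norm_mul, norm_mul, norm_pow, Real.norm_eq_abs, Real.norm_eq_abs, Real.norm_eq_abs, Nat.abs_cast]
      have : |z| ≤ r := (abs_lt.2 hz).le
      gcongr) (y₀ := 0) (by simpa using hr) (hp 0 (by simp)) (abs_lt.1 hr1)
  refine HasDerivAt.congr_deriv (f := ev p) key ?_
  unfold ev
  have hs : Summable fun n => PowerSeries.coeff n p * (n * y ^ (n-1)) := by
    refine Summable.of_norm_bounded h fun n => ?_
    rw [norm_mul, norm_mul, norm_pow, Real.norm_eq_abs, Real.norm_eq_abs, Real.norm_eq_abs, Nat.abs_cast]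
    gcongr
  rw [hs.tsum_eq_zero_add]
  simp only [PowerSeries.coeff_derivative, Nat.add_sub_cancel]
  push_cast
  simp only [zero_mul, mul_zero, zero_add]
  exact tsum_congr fun n => by ring

lemma good_hyp (A B C : ℝ) (hC : 0 < C) : good (hyp A B C) := by
  intro y hy
  obtain ⟨r, hr1, hr2⟩ := exists_between hy
  apply summable_of_ratio_norm_eventually_le hr2
  have hinv : Filter.Tendsto (fun n : ℕ => ((n:ℝ))⁻¹) Filter.atTop (nhds 0) :=
    tendsto_inv_atTop_nhds_zero_nat
  have hl : Filter.Tendsto (fun n : ℕ => |(A * (n:ℝ)⁻¹ + 1) * (B * (n:ℝ)⁻¹ + 1) /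
      ((1 + (n:ℝ)⁻¹) * (C * (n:ℝ)⁻¹ + 1)) * y|) Filter.atTop
      (nhds |(A * 0 + 1) * (B * 0 + 1) / ((1 + 0) * (C * 0 + 1)) * y|) := by
    apply Filter.Tendsto.abs
    refine Filter.Tendsto.mul_const _ (Filter.Tendsto.div ?_ ?_ (by norm_num))
    · exact ((hinv.const_mul A).add_const 1).mul ((hinv.const_mul B).add_const 1)
    · exact ((hinv.const_add 1)).mul ((hinv.const_mul C).add_const 1)
  have hl' := hl.eventually_lt_const (u := r) (by simpa using hr1)
  filter_upwards [hl', Filter.eventually_gt_atTop 0] with n hn hn0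
  have hn0' : (0:ℝ) < n := by exact_mod_cast hn0
  have hrec := hyp_rec A B C hC n
  have e : PowerSeries.coeff (n+1) (hyp A B C) * y ^ (n+1) =
      ((A * (n:ℝ)⁻¹ + 1) * (B * (n:ℝ)⁻¹ + 1) /
      ((1 + (n:ℝ)⁻¹) * (C * (n:ℝ)⁻¹ + 1)) * y) * (PowerSeries.coeff n (hyp A B C) * y ^ n) := by
    have h1 : PowerSeries.coeff (n+1) (hyp A B C) =
      (A + n) * (B + n) * PowerSeries.coeff n (hyp A B C) / (((n:ℝ)+1) * (C + n)) := by
      rw [eq_div_iff (by positivity), ← hrec]; ring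
    rw [h1]
    field_simp
    ring
  rw [e, norm_mul]
  gcongr
  exact hn.le

lemma good_binS (s : ℝ) : good (binS s) := by
  have : binS s = hyp s 1 1 := by
    ext n
    have := (poch_pos one_pos n).ne'
    simp [binS, hyp]
    field_simp
  rw [this]; exact good_hyp _ _ _ one_pos

lemma ev_zero_right (p : PowerSeries ℝ) : ev p 0 = PowerSeries.coeff 0 p := by
  unfold ev
  rw [tsum_eq_single 0 (fun n hn => by simp [hn])]
  simp

lemma ev_binS (s : ℝ) {y : ℝ} (hy : |y| < 1) : ev (binS s) y = (1 - y) ^ (-s) := by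
  have hd : ∀ z ∈ Set.Ioo (-1:ℝ) 1, HasDerivAt (fun z => ev (binS s) z * (1 - z) ^ s) 0 z := by
    intro z hz
    have hz' : |z| < 1 := abs_lt.2 hz
    have h1z : 0 < 1 - z := by linarith [hz.2]
    have h1 := hasDerivAt_ev (good_binS s) hz'
    have h2 : HasDerivAt (fun z : ℝ => (1 - z) ^ s) (-1 * s * (1 - z) ^ (s - 1)) z :=
      ((hasDerivAt_id z).const_sub 1).rpow_const (Or.inl h1z.ne')
    have h3 := congrArg (fun p => ev p z) (binS_ode s)
    rw [ev_mul (good_sub good_one good_X) (good_D (good_binS s)) hz',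
      ev_mul (good_C s) (good_binS s) hz', ev_sub good_one good_X hz', ev_one, ev_X, ev_C] at h3
    refine (h1.mul h2).congr_deriv ?_
    have h4 : (1 - z) ^ s = (1 - z) ^ (s - 1) * (1 - z) := by
      rw [← Real.rpow_add_one h1z.ne']; congr 1; ring
    rw [h4]
    linear_combination (1 - z) ^ (s - 1) * h3
  have hc := IsOpen.is_const_of_deriv_eq_zero (isOpen_Ioo (a := (-1:ℝ)) (b := 1)) isPreconnected_Ioo
    (fun z hz => (hd z hz).differentiableAt.differentiableWithinAt) (fun z hz => (hd z hz).deriv)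
    (x := y) (y := 0) (abs_lt.1 hy) (by norm_num)
  have h1y : 0 < 1 - y := by linarith [(abs_lt.1 hy).2]
  rw [ev_zero_right] at hc
  simp [binS, poch_zero] at hc
  rw [Real.rpow_neg h1y.le]
  exact eq_inv_of_mul_eq_one_left hc

lemma euler_ev (A B C : ℝ) (hC : 0 < C) {y : ℝ} (hy : |y| < 1) :
    ev (hyp A B C) y = (1 - y) ^ (C - A - B) * ev (hyp (C - A) (C - B) C) y := by
  rw [euler_formal A B C hC, ev_mul (good_binS _) (good_hyp _ _ _ hC) hy, ev_binS _ hy]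
  congr 2; ring

lemma hyp_ode_ev (A B C : ℝ) (hC : 0 < C) {y : ℝ} (hy : |y| < 1) :
    y * (1 - y) * ev (PowerSeries.derivative ℝ (PowerSeries.derivative ℝ (hyp A B C))) y
    + (C - (A + B + 1) * y) * ev (PowerSeries.derivative ℝ (hyp A B C)) y
    - A * B * ev (hyp A B C) y = 0 := by
  have h := congrArg (fun p => ev p y) (hypL_hyp A B C hC)
  have g0 := good_hyp A B C hC
  have g1 := good_D g0
  have g2 := good_D g1
  have gm := good_sub good_one good_X
  have gx := good_mul good_X gm
  have gc := good_mul (good_C (A+B+1)) good_X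
  have gd := good_sub (good_C C) gc
  have z : ev 0 y = 0 := by simpa using ev_C 0 y
  unfold hypL at h
  rw [z, ev_sub (good_add (good_mul gx g2) (good_mul gd g1)) (good_mul (good_C _) g0) hy,
    ev_add (good_mul gx g2) (good_mul gd g1) hy, ev_mul gx g2 hy, ev_mul gd g1 hy,
    ev_mul (good_C _) g0 hy, ev_mul good_X gm hy, ev_sub good_one good_X hy,
    ev_sub (good_C C) gc hy, ev_mul (good_C _) good_X hy, ev_one, ev_X] at h
  simp only [ev_C] at h
  exact h

lemma sin_sq_lt {θ : ℝ} (h : θ ∈ Set.Ioo (-π) π) : |sin (θ/2) ^ 2| < 1 := by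
  have hc : 0 < cos (θ/2) := Real.cos_pos_of_mem_Ioo ⟨by linarith [h.1], by linarith [h.2]⟩
  rw [abs_of_nonneg (sq_nonneg _)]
  nlinarith [Real.sin_sq_add_cos_sq (θ/2)]

lemma cos_eq_ev (a : ℝ) (ha : 0 < a) {θ : ℝ} (hθ : θ ∈ Set.Ioo (-π) π) :
    cos (a * θ) = cos (θ/2) * ev (hyp (1/2 + a) (1/2 - a) (1/2)) (sin (θ/2) ^ 2) := by
  set F := hyp (1/2 + a) (1/2 - a) (1/2) with hF
  have g0 : good F := good_hyp _ _ _ (by norm_num)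
  have g1 := good_D g0
  let h : ℝ → ℝ := fun t => cos (t/2) * ev F (sin (t/2) ^ 2)
  let h1 : ℝ → ℝ := fun t => -(1/2) * sin (t/2) * ev F (sin (t/2) ^ 2)
    + sin (t/2) * cos (t/2) ^ 2 * ev (PowerSeries.derivative ℝ F) (sin (t/2) ^ 2)
  have hs : ∀ t : ℝ, HasDerivAt (fun t => sin (t/2)) (cos (t/2) * (1/2)) t := fun t =>
    ((hasDerivAt_id t).div_const 2).sin
  have hc : ∀ t : ℝ, HasDerivAt (fun t => cos (t/2)) (-sin (t/2) * (1/2)) t := fun t =>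
    ((hasDerivAt_id t).div_const 2).cos
  have hy : ∀ t : ℝ, HasDerivAt (fun t => sin (t/2) ^ 2) (sin (t/2) * cos (t/2)) t := fun t =>
    ((hs t).pow 2).congr_deriv (by push_cast; ring)
  have e0 : ∀ t ∈ Set.Ioo (-π) π, HasDerivAt (fun t => ev F (sin (t/2) ^ 2))
      (ev (PowerSeries.derivative ℝ F) (sin (t/2) ^ 2) * (sin (t/2) * cos (t/2))) t := fun t ht =>
    HasDerivAt.comp t (h₂ := ev F) (hasDerivAt_ev g0 (sin_sq_lt ht)) (hy t)
  have e1 : ∀ t ∈ Set.Ioo (-π) π,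
      HasDerivAt (fun t => ev (PowerSeries.derivative ℝ F) (sin (t/2) ^ 2))
      (ev (PowerSeries.derivative ℝ (PowerSeries.derivative ℝ F)) (sin (t/2) ^ 2)
        * (sin (t/2) * cos (t/2))) t := fun t ht =>
    HasDerivAt.comp t (h₂ := ev (PowerSeries.derivative ℝ F))
      (hasDerivAt_ev g1 (sin_sq_lt ht)) (hy t)
  have d0 : ∀ t ∈ Set.Ioo (-π) π, HasDerivAt h (h1 t) t := fun t ht =>
    ((hc t).mul (e0 t ht)).congr_deriv (by simp only [h1]; ring)
  have d1 : ∀ t ∈ Set.Ioo (-π) π, HasDerivAt h1 (-a^2 * h t) t := fun t ht => by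
    refine ((((hs t).const_mul (-(1/2))).mul (e0 t ht)).add
      (((hs t).mul ((hc t).pow 2)).mul (e1 t ht))).congr_deriv ?_
    have ode := hyp_ode_ev (1/2 + a) (1/2 - a) (1/2) (by norm_num) (sin_sq_lt ht)
    rw [← hF] at ode
    have hsc : cos (t/2) ^ 2 = 1 - sin (t/2) ^ 2 := by linarith [Real.sin_sq_add_cos_sq (t/2)]
    simp only [h, Pi.mul_apply, Pi.pow_apply]
    generalize ev (PowerSeries.derivative ℝ (PowerSeries.derivative ℝ F)) (sin (t/2) ^ 2) = f2 at *
    generalize ev (PowerSeries.derivative ℝ F) (sin (t/2) ^ 2) = f1 at *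
    generalize ev F (sin (t/2) ^ 2) = f0 at *
    generalize sin (t/2) = S at *
    generalize cos (t/2) = c at *
    push_cast
    linear_combination c * ode + (c * f1 / 2 + c * S^2 * f2) * hsc
  have hsa : ∀ t : ℝ, HasDerivAt (fun t => sin (a * t)) (cos (a * t) * a) t := fun t => by
    simpa using ((hasDerivAt_id t).const_mul a).sin
  have hca : ∀ t : ℝ, HasDerivAt (fun t => cos (a * t)) (-sin (a * t) * a) t := fun t => by
    simpa using ((hasDerivAt_id t).const_mul a).cos
  have k1 : ∀ t ∈ Set.Ioo (-π) π,
      HasDerivAt (fun t => a * (h t * cos (a * t)) - h1 t * sin (a * t)) 0 t := fun t ht =>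
    ((((d0 t ht).mul (hca t)).const_mul a).sub ((d1 t ht).mul (hsa t))).congr_deriv (by ring)
  have k2 : ∀ t ∈ Set.Ioo (-π) π,
      HasDerivAt (fun t => a * (h t * sin (a * t)) + h1 t * cos (a * t)) 0 t := fun t ht =>
    ((((d0 t ht).mul (hsa t)).const_mul a).add ((d1 t ht).mul (hca t))).congr_deriv (by ring)
  have m0 : (0:ℝ) ∈ Set.Ioo (-π) π := ⟨by linarith [Real.pi_pos], Real.pi_pos⟩
  have c1 := IsOpen.is_const_of_deriv_eq_zero (isOpen_Ioo (a := -π) (b := π)) isPreconnected_Ioo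
    (fun z hz => (k1 z hz).differentiableAt.differentiableWithinAt) (fun z hz => (k1 z hz).deriv)
    hθ m0
  have c2 := IsOpen.is_const_of_deriv_eq_zero (isOpen_Ioo (a := -π) (b := π)) isPreconnected_Ioo
    (fun z hz => (k2 z hz).differentiableAt.differentiableWithinAt) (fun z hz => (k2 z hz).deriv)
    hθ m0
  have h00 : h 0 = 1 := by
    simp [h, ev_zero_right, hF, hyp, poch_zero]
  have h10 : h1 0 = 0 := by simp [h1]
  simp only [h00, h10, mul_zero, Real.cos_zero, Real.sin_zero] at c1 c2
  change cos (a * θ) = h θ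
  apply mul_left_cancel₀ ha.ne'
  linear_combination -cos (a*θ) * c1 - sin (a*θ) * c2 + a * h θ * Real.sin_sq_add_cos_sq (a*θ)

lemma beta_real {s t x : ℝ} (hs : 0 < s) (ht : 0 < t) (hx : 0 < x) :
    ∫ y in Set.Ioo 0 x, y ^ (s - 1) * (x - y) ^ (t - 1) =
      x ^ (s + t - 1) * (Real.Gamma s * Real.Gamma t / Real.Gamma (s + t)) := by
  have h := Complex.betaIntegral_scaled s t hx
  rw [Complex.betaIntegral_eq_Gamma_mul_div _ _ (by simpa using hs) (by simpa using ht),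
    intervalIntegral.integral_of_le hx.le, MeasureTheory.integral_Ioc_eq_integral_Ioo] at h
  have e : ∫ y in Set.Ioo 0 x, (y : ℂ) ^ ((s:ℂ) - 1) * ((x:ℂ) - y) ^ ((t:ℂ) - 1) =
      ∫ y in Set.Ioo 0 x, ((y ^ (s - 1) * (x - y) ^ (t - 1) : ℝ) : ℂ) := by
    refine MeasureTheory.setIntegral_congr_fun measurableSet_Ioo fun y hy => ?_
    have h1 : 0 ≤ x - y := by linarith [hy.2]
    rw [Complex.ofReal_mul, Complex.ofReal_cpow hy.1.le, Complex.ofReal_cpow h1]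
    push_cast; rfl
  rw [e, integral_complex_ofReal, ← Complex.ofReal_add, Complex.Gamma_ofReal, Complex.Gamma_ofReal,
    Complex.Gamma_ofReal, ← Complex.ofReal_one, ← Complex.ofReal_sub,
    ← Complex.ofReal_cpow hx.le] at h
  exact_mod_cast h

lemma beta_real_int {s t x : ℝ} (hs : 0 < s) (ht : 0 < t) (hx : 0 < x) :
    MeasureTheory.IntegrableOn (fun y => y ^ (s - 1) * (x - y) ^ (t - 1)) (Set.Ioo 0 x) := by
  apply MeasureTheory.Integrable.of_integral_ne_zero
  rw [beta_real hs ht hx]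
  have := Real.Gamma_pos_of_pos hs
  have := Real.Gamma_pos_of_pos ht
  have := Real.Gamma_pos_of_pos (add_pos hs ht)
  positivity

lemma beta_term (lam x : ℝ) (hl : 0 < lam) (hx : 0 < x) (c : ℝ) (n : ℕ) :
    ∫ y in Set.Ioo 0 x, c * (y ^ ((n:ℝ) + 1/2 - 1) * (x - y) ^ (lam - 1)) =
     (x ^ (lam - 1/2) * (√π * Real.Gamma lam / Real.Gamma (lam + 1/2))) *
      (c * (poch (1/2) n / poch (lam + 1/2) n) * x ^ n) := by
  rw [MeasureTheory.integral_const_mul, beta_real (by positivity) hl hx]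
  have e1 : (n:ℝ) + 1/2 + lam - 1 = (lam - 1/2) + n := by ring
  have e2 : (n:ℝ) + 1/2 + lam = (lam + 1/2) + n := by ring
  have e3 : (n:ℝ) + 1/2 = 1/2 + n := by ring
  rw [e1, e2, e3, Real.rpow_add_natCast hx.ne', Gamma_poch (by norm_num), Gamma_poch (by positivity),
    Real.Gamma_one_half_eq]
  have := (poch_pos (by positivity : 0 < lam + 1/2) n).ne'
  have := (Real.Gamma_pos_of_pos (by positivity : 0 < lam + 1/2)).ne'
  field_simp

lemma hyp_half (A B C : ℝ) (n : ℕ) :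
    PowerSeries.coeff n (hyp A B (1/2)) * (poch (1/2) n / poch C n) =
      PowerSeries.coeff n (hyp A B C) := by
  have := (poch_pos (by norm_num : (0:ℝ) < 1/2) n).ne'
  simp only [hyp, PowerSeries.coeff_mk]
  field_simp

lemma int_ev (A B lam x : ℝ) (hl : 0 < lam) (hx : 0 < x) (hx1 : x < 1) :
    ∫ y in Set.Ioo 0 x, ev (hyp A B (1/2)) y * (y ^ (-(1/2) : ℝ) * (x - y) ^ (lam - 1)) =
      (x ^ (lam - 1/2) * (√π * Real.Gamma lam / Real.Gamma (lam + 1/2))) *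
        ev (hyp A B (lam + 1/2)) x := by
  have hxa : |x| < 1 := by rwa [abs_of_pos hx]
  have hC : 0 < lam + 1/2 := by positivity
  set K := x ^ (lam - 1/2) * (√π * Real.Gamma lam / Real.Gamma (lam + 1/2))
  let G : ℕ → ℝ → ℝ := fun n y => PowerSeries.coeff n (hyp A B (1/2)) *
    (y ^ ((n:ℝ) + 1/2 - 1) * (x - y) ^ (lam - 1))
  have hint : ∀ n, ∫ y in Set.Ioo 0 x, G n y =
      K * (PowerSeries.coeff n (hyp A B (lam + 1/2)) * x ^ n) := fun n => by
    simp only [G]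
    rw [beta_term lam x hl hx, hyp_half]
  have hnorm : ∀ n, ∫ y in Set.Ioo 0 x, ‖G n y‖ =
      K * (‖PowerSeries.coeff n (hyp A B (lam + 1/2)) * x ^ n‖) := fun n => by
    have : ∫ y in Set.Ioo 0 x, ‖G n y‖ = ∫ y in Set.Ioo 0 x, |PowerSeries.coeff n (hyp A B (1/2))| *
        (y ^ ((n:ℝ) + 1/2 - 1) * (x - y) ^ (lam - 1)) := by
      refine MeasureTheory.setIntegral_congr_fun measurableSet_Ioo fun y hy => ?_
      have h0 := hy.1
      have h1 : 0 < x - y := by linarith [hy.2]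
      simp only [G]
      rw [norm_mul, Real.norm_eq_abs, Real.norm_eq_abs, abs_of_nonneg (a := _ * _) (by positivity)]
    rw [this, beta_term lam x hl hx, ← hyp_half A B (lam + 1/2) n, Real.norm_eq_abs, abs_mul, abs_mul,
      abs_of_pos (pow_pos hx n), abs_of_pos (div_pos (poch_pos (by norm_num) n) (poch_pos hC n))]
  have H := MeasureTheory.hasSum_integral_of_summable_integral_norm
    (μ := MeasureTheory.volume.restrict (Set.Ioo 0 x)) (F := G)
    (fun n => (beta_real_int (by positivity) hl hx).const_mul _)
    (by
      simp_rw [hnorm]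
      exact (good_hyp A B _ hC x hxa).norm.mul_left K)
  simp_rw [hint] at H
  have H2 := ((good_hyp A B _ hC x hxa).hasSum.mul_left K)
  rw [show ev (hyp A B (lam + 1/2)) x =
    ∑' n, PowerSeries.coeff n (hyp A B (lam + 1/2)) * x ^ n from rfl, ← H.unique H2]
  refine MeasureTheory.setIntegral_congr_fun measurableSet_Ioo fun y hy => ?_
  simp only [ev, G]
  rw [← tsum_mul_right]
  refine tsum_congr fun n => ?_
  have : (n:ℝ) + 1/2 - 1 = -(1/2) + n := by ring
  rw [this, Real.rpow_add_natCast hy.1.ne']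
  ring

lemma image_sin_sq {φ : ℝ} (hφ : φ ∈ Set.Ioo 0 π) :
    Set.InjOn (fun t => sin (t/2) ^ 2) (Set.Ioo 0 φ) ∧
    (fun t => sin (t/2) ^ 2) '' Set.Ioo 0 φ = Set.Ioo 0 (sin (φ/2) ^ 2) := by
  have hm : StrictMonoOn (fun t => sin (t/2) ^ 2) (Set.Icc 0 φ) := by
    intro u hu v hv huv
    have h1 : sin (u/2) < sin (v/2) := Real.strictMonoOn_sin
      ⟨by linarith [hu.1, Real.pi_pos], by linarith [hu.2, hφ.2]⟩
      ⟨by linarith [hv.1, Real.pi_pos], by linarith [hv.2, hφ.2]⟩ (by linarith)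
    have h0 : 0 ≤ sin (u/2) := Real.sin_nonneg_of_nonneg_of_le_pi (by linarith [hu.1])
      (by linarith [hu.2, hφ.2, Real.pi_pos])
    simp only
    gcongr
  refine ⟨(hm.mono Set.Ioo_subset_Icc_self).injOn, ?_⟩
  apply Set.Subset.antisymm
  · rintro _ ⟨t, ht, rfl⟩
    have a := hm (Set.left_mem_Icc.2 hφ.1.le) (Set.Ioo_subset_Icc_self ht) ht.1
    have b := hm (Set.Ioo_subset_Icc_self ht) (Set.right_mem_Icc.2 hφ.1.le) ht.2
    simp at a b
    exact ⟨by simpa using a, b⟩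
  · have := intermediate_value_Ioo (f := fun t => sin (t/2) ^ 2) hφ.1.le (by fun_prop)
    simpa using this

theorem ggf_integral_representation (lam nu : ℝ) (hlam : 0 < lam) (hnu : 0 ≤ nu)
    (φ : ℝ) (hφ : φ ∈ Set.Ioo 0 π) :
    Real.sin φ ^ (2 * lam - 1) * rG lam nu (Real.cos φ) =
      (2 ^ lam * Real.Gamma (lam + 1 / 2)) / (Real.sqrt π * Real.Gamma lam) *
        ∫ ϑ in (0 : ℝ)..φ,
          Real.cos ((nu + lam) * ϑ) * (Real.cos ϑ - Real.cos φ) ^ (lam - 1) := by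
  have hS : 0 < sin (φ/2) := Real.sin_pos_of_pos_of_lt_pi (by linarith [hφ.1])
    (by linarith [hφ.2, Real.pi_pos])
  have hc : 0 < cos (φ/2) := Real.cos_pos_of_mem_Ioo
    ⟨by linarith [hφ.1, Real.pi_pos], by linarith [hφ.2]⟩
  have hsc := Real.sin_sq_add_cos_sq (φ/2)
  set x := sin (φ/2) ^ 2 with hx
  have hx0 : 0 < x := by positivity
  have hx1 : x < 1 := by nlinarith
  have hcos : ∀ t : ℝ, cos t = 1 - 2 * sin (t/2) ^ 2 := fun t => by
    have := Real.cos_two_mul (t/2)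
    have h2 := Real.sin_sq_add_cos_sq (t/2)
    rw [show 2 * (t/2) = t by ring] at this
    linarith
  have hrG : rG lam nu (cos φ) = ev (hyp (-nu) (nu + 2 * lam) (lam + 1/2)) x := by
    unfold rG ev
    refine tsum_congr fun n => ?_
    rw [hcos φ, ← hx]
    simp only [hyp, PowerSeries.coeff_mk]
    congr 2; ring
  obtain ⟨hinj, him⟩ := image_sin_sq hφ
  have hI : ∫ ϑ in (0 : ℝ)..φ, cos ((nu + lam) * ϑ) * (cos ϑ - cos φ) ^ (lam - 1) =
      2 ^ (lam - 1) * ∫ y in Set.Ioo 0 x,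
        ev (hyp (1/2 + (nu + lam)) (1/2 - (nu + lam)) (1/2)) y *
          (y ^ (-(1/2) : ℝ) * (x - y) ^ (lam - 1)) := by
    rw [intervalIntegral.integral_of_le hφ.1.le, MeasureTheory.integral_Ioc_eq_integral_Ioo, ← him,
      MeasureTheory.integral_image_eq_integral_abs_deriv_smul (f' := fun t => sin (t/2) * cos (t/2))
        measurableSet_Ioo (fun t _ => by
          have : HasDerivAt (fun t => sin (t/2)) (cos (t/2) * (1/2)) t :=
            ((hasDerivAt_id t).div_const 2).sin
          exact ((this.pow 2).congr_deriv (by push_cast; ring)).hasDerivWithinAt) hinj,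
      ← MeasureTheory.integral_const_mul]
    refine MeasureTheory.setIntegral_congr_fun measurableSet_Ioo fun t ht => ?_
    have hSt : 0 < sin (t/2) := Real.sin_pos_of_pos_of_lt_pi (by linarith [ht.1])
      (by linarith [ht.2, hφ.2, Real.pi_pos])
    have hct : 0 < cos (t/2) := Real.cos_pos_of_mem_Ioo
      ⟨by linarith [ht.1, Real.pi_pos], by linarith [ht.2, hφ.2]⟩
    have hlt : sin (t/2) ^ 2 < x := by
      have := him.le ⟨t, ht, rfl⟩
      exact this.2
    simp only [smul_eq_mul]
    rw [cos_eq_ev (nu + lam) (by positivity) ⟨by linarith [ht.1, Real.pi_pos], by linarith [ht.2, hφ.2]⟩,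
      abs_of_pos (mul_pos hSt hct), hcos t, hcos φ, ← hx,
      show 1 - 2 * sin (t/2) ^ 2 - (1 - 2 * x) = 2 * (x - sin (t/2) ^ 2) by ring,
      Real.mul_rpow (by norm_num) (by linarith)]
    have h1 : (sin (t/2) ^ 2) ^ (-(1/2) : ℝ) = (sin (t/2))⁻¹ := by
      rw [← Real.rpow_natCast, ← Real.rpow_mul hSt.le, ← Real.rpow_neg_one]
      norm_num
    rw [h1]
    field_simp
  rw [hrG, hI, int_ev _ _ _ _ hlam hx0 hx1,
    euler_ev (1/2 + (nu + lam)) (1/2 - (nu + lam)) _ (by positivity) (by rwa [abs_of_pos hx0])]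
  rw [show lam + 1/2 - (1/2 + (nu + lam)) = -nu by ring,
    show lam + 1/2 - (1/2 - (nu + lam)) = nu + 2 * lam by ring,
    show -nu - (1/2 - (nu + lam)) = lam - 1/2 by ring]
  have hG := (Real.Gamma_pos_of_pos hlam).ne'
  have hG2 := (Real.Gamma_pos_of_pos (by positivity : 0 < lam + 1/2)).ne'
  have hpi : √π ≠ 0 := (Real.sqrt_pos.2 Real.pi_pos).ne'
  have hsin : sin φ = 2 * sin (φ/2) * cos (φ/2) := by
    rw [← Real.sin_two_mul]; congr 1; ring
  have e1 : x ^ (lam - 1/2) = sin (φ/2) ^ (2 * lam - 1) := by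
    rw [hx, ← Real.rpow_natCast, ← Real.rpow_mul hS.le]; congr 1; push_cast; ring
  have e2 : (1 - x) ^ (lam - 1/2) = cos (φ/2) ^ (2 * lam - 1) := by
    rw [show 1 - x = cos (φ/2) ^ 2 by linarith, ← Real.rpow_natCast, ← Real.rpow_mul hc.le]
    congr 1; push_cast; ring
  have e3 : (2:ℝ) ^ (2 * lam - 1) = 2 ^ lam * 2 ^ (lam - 1) := by
    rw [← Real.rpow_add (by norm_num)]; congr 1; ring
  rw [hsin, Real.mul_rpow (by positivity) hc.le, Real.mul_rpow (by norm_num) hS.le, e1, e2, e3]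
  field_simp
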